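/- Let X be a reduced G-tree. If x and y are distinct vertices of X with G_x ⊆ G_y, then there is a hyperbolic element t ∈ G such that G_x ⊆ t G_x t⁻¹. -/

import Mathlib

universe u

/-- A `G`-tree: a simplicial tree together with an action of `G` by graph
automorphisms without inversions. -/
structure GTree (G : Type u) [Group G] : Type (u + 1) where
  V : Type u
  graph : SimpleGraph V
  isTree : graph.IsTree
  smul : G → V → V
  smul_one : ∀ x, smul 1 x = x
  smul_mul : ∀ γ δ x, smul (γ * δ) x = smul γ (smul δ x)
  smul_adj : ∀ (γ : G) ⦃x y : V⦄, graph.Adj x y → graph.Adj (smul γ x) (smul γ y)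
  no_inversions : ∀ (γ : G) (x y : V), graph.Adj x y → ¬(smul γ x = y ∧ smul γ y = x)

namespace GTree

variable {G : Type u} [Group G]

/-- Oriented edges of a `G`-tree. -/
def Edge (X : GTree G) : Type u := { p : X.V × X.V // X.graph.Adj p.1 p.2 }

/-- Initial vertex `∂₀ e` of an oriented edge. -/
def d0 {X : GTree G} (e : X.Edge) : X.V := e.1.1

/-- Terminal vertex `∂₁ e` of an oriented edge. -/
def d1 {X : GTree G} (e : X.Edge) : X.V := e.1.2

/-- The underlying geometric (unoriented) edge. -/
def esym {X : GTree G} (e : X.Edge) : Sym2 X.V := s(e.1.1, e.1.2)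

/-- Action of `G` on oriented edges. -/
def edgeSmul {X : GTree G} (γ : G) (e : X.Edge) : X.Edge :=
  ⟨(X.smul γ e.1.1, X.smul γ e.1.2), X.smul_adj γ e.2⟩

/-- Vertex stabilizer `G_x`. -/
def stab (X : GTree G) (x : X.V) : Subgroup G where
  carrier := { γ | X.smul γ x = x }
  one_mem' := X.smul_one x
  mul_mem' := by
    intro a b ha hb
    simp only [Set.mem_setOf_eq] at *
    rw [X.smul_mul, hb, ha]
  inv_mem' := by
    intro a ha
    simp only [Set.mem_setOf_eq] at *
    conv_lhs => rw [← ha]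
    rw [← X.smul_mul, inv_mul_cancel, X.smul_one]

/-- Edge stabilizer `G_e`: the elements fixing both endpoints (since the action
is without inversions, these are exactly the elements fixing the edge). -/
def edgeStab (X : GTree G) (e : X.Edge) : Subgroup G :=
  X.stab (d0 e) ⊓ X.stab (d1 e)

/-- An element of `G` is elliptic if it fixes a vertex. -/
def Elliptic (X : GTree G) (γ : G) : Prop := ∃ x, X.smul γ x = x

/-- A subgroup of `G` is elliptic if it fixes a vertex. -/
def FixesVertex (X : GTree G) (H : Subgroup G) : Prop := ∃ x, ∀ γ ∈ H, X.smul γ x = x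

/-- Two `G`-trees have the same elliptic subgroups. -/
def SameEllipticSubgroups (X Y : GTree G) : Prop :=
  ∀ H : Subgroup G, X.FixesVertex H ↔ Y.FixesVertex H

/-- The length function `ℓ_X(γ)`: the minimal vertex displacement. -/
noncomputable def transLen (X : GTree G) (γ : G) : ℕ :=
  sInf (Set.range fun x => X.graph.dist x (X.smul γ x))

/-- Cocompact: the quotient graph `G\X` is finite, i.e. there are finitely
many orbits of vertices and of edges. -/
def Cocompact (X : GTree G) : Prop :=
  Finite (Quot fun x y : X.V => ∃ γ, X.smul γ x = y) ∧
    Finite (Quot fun e f : X.Edge => ∃ γ, edgeSmul γ e = f)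

/-- Reduced: whenever `G_e = G_{∂₀ e}`, the endpoints of `e` are in the same
`G`-orbit. -/
def Reduced (X : GTree G) : Prop :=
  ∀ e : X.Edge, X.edgeStab e = X.stab (d0 e) → ∃ γ, X.smul γ (d0 e) = d1 e

/-- A nonempty `G`-invariant subtree (a nonempty invariant set of vertices that
is connected in the induced graph). -/
def IsInvariantSubtree (X : GTree G) (S : Set X.V) : Prop :=
  S.Nonempty ∧ (∀ γ, ∀ x ∈ S, X.smul γ x ∈ S) ∧
    ∀ x ∈ S, ∀ y ∈ S, ∃ p : X.graph.Walk x y, ∀ v ∈ p.support, v ∈ S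

/-- Minimal: there is no proper nonempty invariant subtree. -/
def Minimal (X : GTree G) : Prop :=
  ∀ S : Set X.V, X.IsInvariantSubtree S → S = Set.univ

/-- Strongly slide-free: minimal, and for all edges `e`, `f` with
`∂₀ e = ∂₀ f`, the inclusion `G_e ⊆ G_f` implies `f ∈ G e`. -/
def StronglySlideFree (X : GTree G) : Prop :=
  X.Minimal ∧ ∀ e f : X.Edge, d0 e = d0 f → X.edgeStab e ≤ X.edgeStab f →
    ∃ γ, edgeSmul γ e = f

/-- Proper: `G_e ⊊ G_{∂₀ e}` for every edge `e`. -/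
def Proper (X : GTree G) : Prop := ∀ e : X.Edge, X.edgeStab e < X.stab (d0 e)

/-- Locally finite: every vertex has finite valence. -/
def LocallyFinite (X : GTree G) : Prop := ∀ x : X.V, (X.graph.neighborSet x).Finite

/-- `φ` is an isomorphism of `G`-trees: an equivariant graph isomorphism. -/
def IsGIso (X Y : GTree G) (φ : X.V → Y.V) : Prop :=
  Function.Bijective φ ∧ (∀ x y, X.graph.Adj x y ↔ Y.graph.Adj (φ x) (φ y)) ∧
    ∀ γ x, φ (X.smul γ x) = Y.smul γ (φ x)

/-- `φ : X → Y` is the collapse move performed at (the orbit of) the edge `e`: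
`G_e = G_{∂₀ e}`, the endpoints of `e` lie in different `G`-orbits, and `Y` is
the equivariant quotient of `X` identifying `∂₀(γ e)` with `∂₁(γ e)` for all
`γ ∈ G`. -/
def IsCollapse (X Y : GTree G) (φ : X.V → Y.V) (e : X.Edge) : Prop :=
  X.edgeStab e = X.stab (d0 e) ∧
  (∀ γ : G, X.smul γ (d0 e) ≠ d1 e) ∧
  Function.Surjective φ ∧
  (∀ γ x, φ (X.smul γ x) = Y.smul γ (φ x)) ∧
  (∀ u v : X.V, φ u = φ v ↔
    Relation.EqvGen (fun a b => ∃ γ : G, a = X.smul γ (d0 e) ∧ b = X.smul γ (d1 e)) u v) ∧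
  (∀ a b : Y.V, a ≠ b → (Y.graph.Adj a b ↔ ∃ u v, X.graph.Adj u v ∧ φ u = a ∧ φ v = b))

/-- `Y` is obtained from `X` by a collapse move. -/
def Collapse (X Y : GTree G) : Prop := ∃ (φ : X.V → Y.V) (e : X.Edge), IsCollapse X Y φ e

/-- Elementary deformation: a finite composition of collapse moves and their
inverses (expansion moves). -/
def ElemDeformation : GTree G → GTree G → Prop := Relation.EqvGen Collapse

end GTree

namespace GTree

variable {G : Type u} [Group G]

/-- The graph endomorphism given by the action of a group element. -/
def smulHom (X : GTree G) (g : G) : X.graph →g X.graph :=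
  ⟨X.smul g, fun h => X.smul_adj g h⟩

theorem smul_inv_smul (X : GTree G) (g : G) (v : X.V) : X.smul g⁻¹ (X.smul g v) = v := by
  rw [← X.smul_mul, inv_mul_cancel, X.smul_one]

theorem smul_injective (X : GTree G) (g : G) : Function.Injective (X.smul g) :=
  Function.LeftInverse.injective (X.smul_inv_smul g)

theorem dist_smul_le (X : GTree G) (g : G) (u v : X.V) :
    X.graph.dist (X.smul g u) (X.smul g v) ≤ X.graph.dist u v := by
  obtain ⟨p, hp⟩ := X.isTree.connected.exists_walk_length_eq_dist u v
  rw [← hp, ← SimpleGraph.Walk.length_map (X.smulHom g) p]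
  exact SimpleGraph.dist_le _

/-- The action on a `G`-tree is by isometries. -/
theorem dist_smul (X : GTree G) (g : G) (u v : X.V) :
    X.graph.dist (X.smul g u) (X.smul g v) = X.graph.dist u v := by
  refine le_antisymm (X.dist_smul_le g u v) ?_
  simpa only [smul_inv_smul] using X.dist_smul_le g⁻¹ (X.smul g u) (X.smul g v)

/-- An element moving a vertex to an adjacent one is hyperbolic. -/
theorem not_elliptic_of_adj_smul (X : GTree G) {t : G} {x : X.V}
    (h : X.graph.Adj x (X.smul t x)) : ¬ X.Elliptic t := by
  rintro ⟨z, hz⟩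
  have hd := X.dist_smul t z x
  rw [hz] at hd
  exact X.isTree.dist_ne_of_adj z h hd.symm

/-- An element fixing both ends of a path in a `G`-tree fixes every vertex of the path. -/
theorem smul_getVert_of_isPath (X : GTree G) {g : G} {x y : X.V} {p : X.graph.Walk x y}
    (hp : p.IsPath) (hx : X.smul g x = x) (hy : X.smul g y = y) (n : ℕ) :
    X.smul g (p.getVert n) = p.getVert n := by
  replace hx : X.smulHom g x = x := hx
  replace hy : X.smulHom g y = y := hy
  have hq : ((p.map (X.smulHom g)).copy hx hy).IsPath := by
    rw [SimpleGraph.Walk.isPath_copy]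
    exact hp.map (X.smul_injective g)
  have he : (p.map (X.smulHom g)).copy hx hy = p :=
    (X.isTree.existsUnique_path x y).unique hq hp
  have hv := congrArg (fun w => w.getVert n) he
  simp only [SimpleGraph.Walk.getVert_copy, SimpleGraph.Walk.getVert_map] at hv
  exact hv

end GTree

open GTree in
/-- Lemma 4.12: let `X` be a reduced `G`-tree.  If `x` and `y` are distinct
vertices of `X` with `G_x ⊆ G_y`, then there is a hyperbolic element `t ∈ G`
such that `G_x ⊆ t G_x t⁻¹` (equivalently, `t⁻¹ g t ∈ G_x` for all
`g ∈ G_x`). -/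
theorem reduced_stab_hyperbolic_conj {G : Type u} [Group G] (X : GTree G)
    (hred : X.Reduced) (x y : X.V) (hxy : x ≠ y) (hsub : X.stab x ≤ X.stab y) :
    ∃ t : G, ¬ X.Elliptic t ∧ ∀ g ∈ X.stab x, t⁻¹ * g * t ∈ X.stab x := by
  obtain ⟨p, hp⟩ := X.isTree.connected.exists_isPath x y
  have hadj : X.graph.Adj x p.snd := p.adj_snd (SimpleGraph.Walk.not_nil_of_ne hxy)
  have hle : X.stab x ≤ X.stab p.snd := fun g hg =>
    X.smul_getVert_of_isPath hp hg (hsub hg) 1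
  obtain ⟨t, ht⟩ := hred ⟨(x, p.snd), hadj⟩ (inf_eq_left.mpr hle)
  change X.smul t x = p.snd at ht
  refine ⟨t, X.not_elliptic_of_adj_smul (ht ▸ hadj), fun g hg => ?_⟩
  have hg' : X.smul g (X.smul t x) = X.smul t x := ht ▸ hle hg
  change X.smul (t⁻¹ * g * t) x = x
  rw [X.smul_mul, X.smul_mul, hg', X.smul_inv_smul]
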